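/- Let C231, C234, C244 be arbitrary real numbers. On the 4-dimensional real vector space with basis y1, y2, y3, y4, the skew-symmetric bilinear bracket determined by [y1,y2]=y3, [y1,y3]=y4, [y1,y4]=0, [y2,y3]=C231·y1 + C244·y3 + C234·y4, [y2,y4]=C244·y4, [y3,y4]=0 satisfies the Jacobi identity (so it defines a Lie algebra, called ourSolDep[4]), and the 2-dimensional subspace D = span{y1,y2} is an Engel-like structure on it. -/

import Mathlib

/-- Bilinear extension of structure constants `c` to a bracket on `Fin 4 → ℝ`. -/
noncomputable def bk (c : Fin 4 → Fin 4 → Fin 4 → ℝ) (x y : Fin 4 → ℝ) : Fin 4 → ℝ :=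
  ∑ i : Fin 4, ∑ j : Fin 4, (x i * y j) • c i j

/-- Structure constants of the Engel-normalized bracket:
`[y1,y2] = y3`, `[y1,y3] = y4`, `[y1,y4] = C14`, `[y2,y3] = C23`,
`[y2,y4] = C24`, `[y3,y4] = C34`, extended skew-symmetrically. -/
noncomputable def sc (C14 C23 C24 C34 : Fin 4 → ℝ) : Fin 4 → Fin 4 → Fin 4 → ℝ :=
  ![![0, ![0, 0, 1, 0], ![0, 0, 0, 1], C14],
    ![-![0, 0, 1, 0], 0, C23, C24],
    ![-![0, 0, 0, 1], -C23, 0, C34],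
    ![-C14, -C24, -C34, 0]]

/-- The subspace spanned by all brackets `B u v` with `u ∈ S`, `v ∈ T`. -/
noncomputable def brS (B : (Fin 4 → ℝ) → (Fin 4 → ℝ) → (Fin 4 → ℝ))
    (S T : Submodule ℝ (Fin 4 → ℝ)) : Submodule ℝ (Fin 4 → ℝ) :=
  Submodule.span ℝ {z | ∃ u ∈ S, ∃ v ∈ T, z = B u v}

/-- `D` is an Engel-like structure for the bracket `B`: `D` is 2-dimensional,
`D[2] = D + [D,D]` is 3-dimensional and `D[3] = D[2] + [D[2],D[2]]` is 4-dimensional. -/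
noncomputable def IsEngelLike (B : (Fin 4 → ℝ) → (Fin 4 → ℝ) → (Fin 4 → ℝ))
    (D : Submodule ℝ (Fin 4 → ℝ)) : Prop :=
  Module.finrank ℝ D = 2 ∧
  Module.finrank ℝ ↥(D ⊔ brS B D D) = 3 ∧
  Module.finrank ℝ ↥((D ⊔ brS B D D) ⊔ brS B (D ⊔ brS B D D) (D ⊔ brS B D D)) = 4

lemma bk_formula (a b d : ℝ) (x y : Fin 4 → ℝ) :
    bk (sc ![0, 0, 0, 0] ![a, 0, d, b] ![0, 0, 0, d] ![0, 0, 0, 0]) x y =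
      ![a * (x 1 * y 2 - x 2 * y 1), 0,
        (x 0 * y 1 - x 1 * y 0) + d * (x 1 * y 2 - x 2 * y 1),
        (x 0 * y 2 - x 2 * y 0) + b * (x 1 * y 2 - x 2 * y 1)
          + d * (x 1 * y 3 - x 3 * y 1)] := by
  funext k
  fin_cases k <;> simp [bk, sc, Fin.sum_univ_four] <;> ring

lemma finrank_D : Module.finrank ℝ
    (Submodule.span ℝ {(![1, 0, 0, 0] : Fin 4 → ℝ), ![0, 1, 0, 0]}) = 2 := by
  have h : LinearIndependent ℝ ![(![1, 0, 0, 0] : Fin 4 → ℝ), ![0, 1, 0, 0]] := by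
    rw [Fintype.linearIndependent_iff]
    intro g hg i
    have h0 := congrFun hg 0
    have h1 := congrFun hg 1
    simp [Fin.sum_univ_two] at h0 h1
    fin_cases i <;> simpa
  have := finrank_span_eq_card h
  rw [Matrix.range_cons, Matrix.range_cons, Matrix.range_empty, Set.union_empty] at this
  exact this.trans (by simp)

lemma finrank_D2 : Module.finrank ℝ
    (Submodule.span ℝ (Set.range ![(![1, 0, 0, 0] : Fin 4 → ℝ), ![0, 1, 0, 0],
      ![0, 0, 1, 0]])) = 3 := by
  have h : LinearIndependent ℝ ![(![1, 0, 0, 0] : Fin 4 → ℝ), ![0, 1, 0, 0],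
      ![0, 0, 1, 0]] := by
    rw [Fintype.linearIndependent_iff]
    intro g hg i
    have h0 := congrFun hg 0
    have h1 := congrFun hg 1
    have h2 := congrFun hg 2
    simp [Fin.sum_univ_three] at h0 h1 h2
    fin_cases i <;> simpa
  simpa using finrank_span_eq_card h

theorem ourSolDep4_lie_and_engel (C231 C234 C244 : ℝ) :
    let c := sc ![0, 0, 0, 0]
      ![C231, 0, C244, C234]
      ![0, 0, 0, C244]
      ![0, 0, 0, 0]
    (∀ x y : Fin 4 → ℝ, bk c x y = -bk c y x) ∧
    (∀ x y z : Fin 4 → ℝ,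
      bk c x (bk c y z) + bk c y (bk c z x) + bk c z (bk c x y) = 0) ∧
    IsEngelLike (bk c)
      (Submodule.span ℝ {(![1, 0, 0, 0] : Fin 4 → ℝ), ![0, 1, 0, 0]}) := by
  intro c
  have hB : ∀ x y, bk c x y = _ := bk_formula C231 C234 C244
  generalize bk c = B at hB
  refine ⟨?_, ?_, ?_⟩
  · intro x y
    rw [hB, hB]
    funext k
    fin_cases k <;> simp <;> ring
  · intro x y z
    simp only [hB]
    funext k
    fin_cases k <;> simp <;> ring
  · set D := Submodule.span ℝ {(![1, 0, 0, 0] : Fin 4 → ℝ), ![0, 1, 0, 0]} with hD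
    have e0 : (![1, 0, 0, 0] : Fin 4 → ℝ) ∈ D := Submodule.subset_span (by simp)
    have e1 : (![0, 1, 0, 0] : Fin 4 → ℝ) ∈ D := Submodule.subset_span (by simp)
    have hDc : ∀ u ∈ D, u 2 = 0 ∧ u 3 = 0 := by
      intro u hu
      obtain ⟨p, q, rfl⟩ := Submodule.mem_span_pair.1 hu
      simp
    have e2 : (![0, 0, 1, 0] : Fin 4 → ℝ) ∈ brS B D D :=
      Submodule.subset_span ⟨_, e0, _, e1, by rw [hB]; simp⟩
    have h2 : D ⊔ brS B D D = Submodule.span ℝ (Set.range ![(![1, 0, 0, 0] : Fin 4 → ℝ),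
        ![0, 1, 0, 0], ![0, 0, 1, 0]]) := by
      apply le_antisymm
      · refine sup_le ?_ ?_
        · rw [hD]
          refine Submodule.span_mono ?_
          rintro x (rfl | rfl)
          · exact ⟨0, rfl⟩
          · exact ⟨1, rfl⟩
        · refine Submodule.span_le.2 ?_
          rintro z ⟨u, hu, v, hv, rfl⟩
          have : B u v = (u 0 * v 1 - u 1 * v 0) • ![0, 0, 1, 0] := by
            rw [hB, (hDc u hu).1, (hDc u hu).2, (hDc v hv).1, (hDc v hv).2]
            simp
          rw [this]
          exact Submodule.smul_mem _ _ (Submodule.subset_span ⟨2, rfl⟩)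
      · refine Submodule.span_le.2 ?_
        rintro x ⟨i, rfl⟩
        fin_cases i
        · exact Submodule.mem_sup_left e0
        · exact Submodule.mem_sup_left e1
        · exact Submodule.mem_sup_right e2
    refine ⟨finrank_D, ?_, ?_⟩
    · rw [h2]; exact finrank_D2
    · have f0 := Submodule.mem_sup_left (T := brS B D D) e0
      have f1 := Submodule.mem_sup_left (T := brS B D D) e1
      have f2 := Submodule.mem_sup_right (S := D) e2
      generalize D ⊔ brS B D D = E at f0 f1 f2
      have e3 : (![0, 0, 0, 1] : Fin 4 → ℝ) ∈ brS B E E :=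
        Submodule.subset_span ⟨_, f0, _, f2, by rw [hB]; simp⟩
      have : E ⊔ brS B E E = ⊤ := by
        rw [eq_top_iff]
        intro x _
        have hx : x = (x 0 • ![1, 0, 0, 0] + x 1 • ![0, 1, 0, 0] + x 2 • ![0, 0, 1, 0])
            + x 3 • ![0, 0, 0, 1] := by
          funext k
          fin_cases k <;> simp
        rw [hx]
        exact Submodule.add_mem_sup (E.add_mem (E.add_mem (E.smul_mem _ f0) (E.smul_mem _ f1))
          (E.smul_mem _ f2)) (Submodule.smul_mem _ _ e3)
      rw [this]
      simp
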